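/- Let a be a real number, let n ≥ 1, and set h = (2n)^{−1/3} and x_i = h·i. Let T be the (2n+1)×(2n+1) tridiagonal matrix with zero main diagonal, every superdiagonal entry equal to √n, and subdiagonal entries given by (2i, 2i−1) entry = (n+1−i)/√n for i=1,…,n and (2i+1, 2i) entry = (a+n−i)/√n for i=1,…,n (this is the shuffled rectangular ∞-Laguerre matrix model). Then −√(2/h)·(T − √2·h^{−3/2}·I_{2n+1}) = (1/h²)·Δ_{2n+1} + diag_{−1}(x_0, x_1, …, x_{2n−1}) + E, where x_0 = 0 and E is the (2n+1)×(2n+1) matrix whose (j+1, j) entry equals −h(2a−1) for every even j ∈ {2,4,…,2n} and all of whose other entries are zero. In particular, if a = 1/2 then E is the zero matrix. -/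

import Mathlib

open Matrix Real

/-- Soft-edge scaling of the superdiagonal. -/
lemma sqrt_two_div_mul_sqrt {h m : ℝ} (h0 : 0 < h) (hm : 2 * m * h ^ 3 = 1) :
    √(2 / h) * √m = 1 / h ^ 2 := by
  rw [← Real.sqrt_mul (by positivity), show 2 / h * m = (1 / h ^ 2) ^ 2 by
    field_simp; linarith, Real.sqrt_sq (by positivity)]

/-- Soft-edge scaling of the subdiagonal. -/
lemma sqrt_two_div_div_sqrt {h m : ℝ} (h0 : 0 < h) (m0 : 0 < m) (hm : 2 * m * h ^ 3 = 1) :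
    √(2 / h) / √m = 2 * h := by
  rw [← Real.sqrt_div (by positivity), show 2 / h / m = (2 * h) ^ 2 by
    field_simp; linarith, Real.sqrt_sq (by positivity)]

/-- Soft-edge scaling of the diagonal shift. -/
lemma sqrt_two_div_mul_shift {h : ℝ} (h0 : 0 < h) :
    √(2 / h) * (√2 * h ^ (-(3/2) : ℝ)) = 2 / h ^ 2 := by
  have hpow : h ^ (-(3/2) : ℝ) = 1 / (h * √h) := by
    rw [Real.rpow_neg h0.le, show (3/2 : ℝ) = 1 + 1/2 by norm_num, Real.rpow_add h0,
      Real.rpow_one, ← Real.sqrt_eq_rpow, one_div]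
  rw [hpow, Real.sqrt_div (by positivity)]
  field_simp
  rw [Real.sq_sqrt (by positivity), Real.sq_sqrt h0.le, mul_comm]

/-- The shuffled rectangular ∞-Laguerre matrix model, scaled at the
soft edge, equals `(1/h²)Δ_{2n+1} + diag₋₁(x₀,x₁,…,x_{2n−1}) + E` where `E` has
entries `−h(2a−1)` at positions `(j+1,j)` for even `j` and zeros elsewhere; in
particular `E = 0` when `a = 1/2`. Here `h = (2n)^{-1/3}` and `x_i = h·i`. -/
theorem laguerre_rectangular_soft_edge_finite_difference (a : ℝ) (n : ℕ) (hn : 1 ≤ n)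
    (h : ℝ) (hh : h = ((2 * n : ℕ) : ℝ) ^ (-(1/3 : ℝ)))
    (x : ℕ → ℝ) (hx : ∀ i, x i = h * i)
    (T : Matrix (Fin (2 * n + 1)) (Fin (2 * n + 1)) ℝ)
    (hT : T = Matrix.of fun (i j : Fin (2 * n + 1)) =>
      if (j : ℕ) = (i : ℕ) + 1 then Real.sqrt n
      else if (i : ℕ) = (j : ℕ) + 1 then
        (if (j : ℕ) % 2 = 0 then ((n : ℝ) - (((j : ℕ) / 2 : ℕ) : ℝ)) / Real.sqrt n
         else (a + (n : ℝ) - ((((j : ℕ) + 1) / 2 : ℕ) : ℝ)) / Real.sqrt n)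
      else 0)
    (Δ : Matrix (Fin (2 * n + 1)) (Fin (2 * n + 1)) ℝ)
    (hΔ : Δ = Matrix.of fun (i j : Fin (2 * n + 1)) =>
      if i = j then 2
      else if (j : ℕ) = (i : ℕ) + 1 ∨ (i : ℕ) = (j : ℕ) + 1 then -1
      else 0)
    (X : Matrix (Fin (2 * n + 1)) (Fin (2 * n + 1)) ℝ)
    (hX : X = Matrix.of fun (i j : Fin (2 * n + 1)) =>
      if (i : ℕ) = (j : ℕ) + 1 then x (j : ℕ) else 0)
    (E : Matrix (Fin (2 * n + 1)) (Fin (2 * n + 1)) ℝ)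
    (hE : E = Matrix.of fun (i j : Fin (2 * n + 1)) =>
      if (i : ℕ) = (j : ℕ) + 1 ∧ (j : ℕ) % 2 = 1 then -h * (2 * a - 1) else 0) :
    (-Real.sqrt (2 / h)) •
        (T - (Real.sqrt 2 * h ^ (-(3/2) : ℝ)) •
          (1 : Matrix (Fin (2 * n + 1)) (Fin (2 * n + 1)) ℝ))
      = (1 / h ^ 2) • Δ + X + E ∧ (a = 1/2 → E = 0) := by
  have n0 : (0 : ℝ) < n := by exact_mod_cast hn
  have h0 : 0 < h := hh ▸ Real.rpow_pos_of_pos (by positivity) _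
  have hcube : 2 * (n : ℝ) * h ^ 3 = 1 := by
    rw [hh, ← Real.rpow_natCast, ← Real.rpow_mul (by positivity)]
    norm_num [Real.rpow_neg_one]
    field_simp
  have hsup := sqrt_two_div_mul_sqrt h0 hcube
  have hsub := sqrt_two_div_div_sqrt h0 n0 hcube
  have hshift := sqrt_two_div_mul_shift h0
  have hinv : 1 / h ^ 2 = 2 * h * n := by
    field_simp
    linarith
  refine ⟨?_, fun ha => ?_⟩
  · subst hT hΔ hX hE
    ext i j
    simp only [Matrix.smul_apply, Matrix.sub_apply, Matrix.add_apply, Matrix.of_apply,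
      smul_eq_mul, Matrix.one_apply, hx, Fin.ext_iff]
    by_cases hdiag : (i : ℕ) = j
    · simp only [hdiag, Nat.left_eq_add, one_ne_zero, if_false, if_true, false_and]
      linear_combination hshift
    by_cases habove : (j : ℕ) = i + 1
    · have hbelow : ¬ (i : ℕ) = j + 1 := by omega
      rw [if_pos habove, if_neg hdiag, if_neg hdiag, if_pos (Or.inl habove), if_neg hbelow,
        if_neg fun hc => hbelow hc.1]
      linear_combination -hsup
    by_cases hbelow : (i : ℕ) = j + 1
    · rcases Nat.mod_two_eq_zero_or_one (j : ℕ) with hpar | hpar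
      · have hhalf : 2 * (((j : ℕ) / 2 : ℕ) : ℝ) = ((j : ℕ) : ℝ) := by
          exact_mod_cast (by omega : 2 * ((j : ℕ) / 2) = j)
        rw [if_neg habove, if_pos hbelow, if_pos hpar, if_neg hdiag, if_neg hdiag,
          if_pos (Or.inr hbelow), if_pos hbelow, if_neg fun hc => by omega]
        linear_combination (-((n : ℝ) - (((j : ℕ) / 2 : ℕ) : ℝ))) * hsub + hinv + h * hhalf
      · have hhalf : 2 * ((((j : ℕ) + 1) / 2 : ℕ) : ℝ) = ((j : ℕ) : ℝ) + 1 := by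
          exact_mod_cast (by omega : 2 * (((j : ℕ) + 1) / 2) = j + 1)
        rw [if_neg habove, if_pos hbelow, if_neg (by omega : ¬ (j : ℕ) % 2 = 0), if_neg hdiag, if_neg hdiag,
          if_pos (Or.inr hbelow), if_pos hbelow, if_pos ⟨hbelow, hpar⟩]
        linear_combination
          (-(a + (n : ℝ) - ((((j : ℕ) + 1) / 2 : ℕ) : ℝ))) * hsub + hinv + h * hhalf
    · simp [hdiag, habove, hbelow]
  · subst hE ha
    ext i j
    simp
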